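/- Blockwise contraction recursion: let p ≥ 1 be a natural number and ϱ ≥ 0 with p·ϱ < 1. Let g : ℕ → ℝ be nonnegative and satisfy g(k) ≤ ϱ·∑_{j=1}^{p} g(k − j) for every k ≥ p. Then for every k, g(k) ≤ (max_{0 ≤ r < p} g(r)) · (p·ϱ)^{⌊k/p⌋}; in particular g(k) → 0 as k → ∞. -/

import Mathlib

/-- Blockwise contraction recursion. -/
theorem blockwise_contraction_recursion (p : ℕ) (hp : 1 ≤ p) (ϱ : ℝ)
    (hϱ : 0 ≤ ϱ) (hpϱ : (p : ℝ) * ϱ < 1) (g : ℕ → ℝ) (hg0 : ∀ k, 0 ≤ g k)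
    (hrec : ∀ k, p ≤ k → g k ≤ ϱ * ∑ j ∈ Finset.Icc 1 p, g (k - j)) :
    (∀ k, g k ≤ ((Finset.range p).sup' (Finset.nonempty_range_iff.mpr (by omega)) g)
        * ((p : ℝ) * ϱ) ^ (k / p)) ∧
    Filter.Tendsto g Filter.atTop (nhds 0) := by
  have hq : 0 ≤ (p : ℝ) * ϱ := by positivity
  set M := (Finset.range p).sup' (Finset.nonempty_range_iff.mpr (by omega)) g
  have hgM : ∀ r < p, g r ≤ M := fun r hr => Finset.le_sup' g (Finset.mem_range.mpr hr)
  have hM0 : 0 ≤ M := (hg0 0).trans (hgM 0 hp)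
  have bound : ∀ k, g k ≤ M * ((p : ℝ) * ϱ) ^ (k / p) := by
    intro k
    induction k using Nat.strong_induction_on with
    | _ k ih =>
      rcases lt_or_ge k p with hk | hk
      · simpa [Nat.div_eq_of_lt hk] using hgM k hk
      · have hterm : ∀ j ∈ Finset.Icc 1 p, g (k - j) ≤ M * ((p : ℝ) * ϱ) ^ ((k - p) / p) := by
          intro j hj
          obtain ⟨h1, h2⟩ := Finset.mem_Icc.mp hj
          exact (ih (k - j) (by omega)).trans (mul_le_mul_of_nonneg_left
            (pow_le_pow_of_le_one hq hpϱ.le (Nat.div_le_div_right (by omega))) hM0)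
        have hdiv : k / p = (k - p) / p + 1 := Nat.div_eq_sub_div hp hk
        calc g k ≤ ϱ * ∑ j ∈ Finset.Icc 1 p, g (k - j) := hrec k hk
          _ ≤ ϱ * ∑ _j ∈ Finset.Icc 1 p, M * ((p : ℝ) * ϱ) ^ ((k - p) / p) :=
            mul_le_mul_of_nonneg_left (Finset.sum_le_sum hterm) hϱ
          _ = M * ((p : ℝ) * ϱ) ^ (k / p) := by
            rw [hdiv, Finset.sum_const, Nat.card_Icc, Nat.add_sub_cancel, nsmul_eq_mul, pow_succ]
            ring
  refine ⟨bound, squeeze_zero hg0 bound ?_⟩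
  simpa using ((tendsto_pow_atTop_nhds_zero_of_lt_one hq hpϱ).comp
    (Nat.tendsto_div_const_atTop (Nat.ne_of_gt hp))).const_mul M
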